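/- Let 𝕜 be a field, let I ⊆ 𝕜[x₁,…,xₙ] be an ideal, and let f₁,…,f_s ∈ 𝕜[x₁,…,xₙ] be polynomials of total degree at most 1 with degree-1 homogeneous parts λ₁,…,λ_s. Then the 𝕜-dimension of 𝕜[x₁,…,xₙ]/(in(I) + (λ₁,…,λ_s)) is at least the 𝕜-dimension of 𝕜[x₁,…,xₙ]/(I + (f₁,…,f_s)); in particular, if an affine k-plane V cut out by f₁,…,f_s satisfies |S ∩ V| ≥ m for the scheme S defined by I, then the parallel k-plane V₀ through the origin cut out by λ₁,…,λ_s satisfies |S₀ ∩ V₀| ≥ m for the dilation degeneration S₀ defined by in(I). -/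

import Mathlib

open MvPolynomial

/-- The top-degree form of a polynomial: its homogeneous component in degree
equal to its total degree. -/
noncomputable def topForm {𝕜 : Type} [Field 𝕜] {n : ℕ}
    (f : MvPolynomial (Fin n) 𝕜) : MvPolynomial (Fin n) 𝕜 :=
  MvPolynomial.homogeneousComponent f.totalDegree f

/-- `in(I)`: the ideal generated by the top-degree forms of the nonzero elements
of `I`; the defining ideal of the dilation degeneration `S₀`. -/
noncomputable def inIdeal {𝕜 : Type} [Field 𝕜] {n : ℕ}
    (I : Ideal (MvPolynomial (Fin n) 𝕜)) : Ideal (MvPolynomial (Fin n) 𝕜) :=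
  Ideal.span {g | ∃ f ∈ I, f ≠ 0 ∧ g = topForm f}

/-- The polynomials all of whose homogeneous components are leading components of elements of
`J`: for every degree `d`, the degree `d` part of the polynomial agrees with that of an element
of `J` of degree at most `d`. -/
def leadingFormIdeal {𝕜 : Type} [Field 𝕜] {n : ℕ}
    (J : Ideal (MvPolynomial (Fin n) 𝕜)) : Ideal (MvPolynomial (Fin n) 𝕜) where
  carrier := {p | ∀ d : ℕ, ∃ h ∈ J, (∀ m, d < m.degree → coeff m h = 0) ∧
    ∀ m, m.degree = d → coeff m h = coeff m p}
  zero_mem' := fun d => ⟨0, J.zero_mem, by simp, by simp⟩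
  add_mem' := by
    intro p q hp hq d
    obtain ⟨h, hJ, h0, h1⟩ := hp d
    obtain ⟨k, kJ, k0, k1⟩ := hq d
    refine ⟨h + k, J.add_mem hJ kJ, fun m hm => ?_, fun m hm => ?_⟩
    · rw [coeff_add, h0 m hm, k0 m hm, add_zero]
    · rw [coeff_add, coeff_add, h1 m hm, k1 m hm]
  smul_mem' := by
    intro r p hp
    induction r using MvPolynomial.induction_on' with
    | monomial u c =>
      intro d
      by_cases hu : u.degree ≤ d
      · obtain ⟨h, hJ, h0, h1⟩ := hp (d - u.degree)
        refine ⟨monomial u c * h, J.mul_mem_left _ hJ, fun m hm => ?_, fun m hm => ?_⟩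
        · rw [coeff_monomial_mul']
          split_ifs with hum
          · have := congrArg Finsupp.degree (tsub_add_cancel_of_le hum)
            rw [map_add] at this
            rw [h0 _ (by omega), mul_zero]
          · rfl
        · rw [smul_eq_mul, coeff_monomial_mul', coeff_monomial_mul']
          split_ifs with hum
          · have := congrArg Finsupp.degree (tsub_add_cancel_of_le hum)
            rw [map_add] at this
            rw [h1 _ (by omega)]
          · rfl
      · refine ⟨0, J.zero_mem, by simp, fun m hm => ?_⟩
        rw [smul_eq_mul, coeff_monomial_mul', if_neg, coeff_zero]
        intro hum
        have := congrArg Finsupp.degree (tsub_add_cancel_of_le hum)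
        rw [map_add] at this
        omega
    | add a b ha hb =>
      intro d
      obtain ⟨h, hJ, h0, h1⟩ := ha d
      obtain ⟨k, kJ, k0, k1⟩ := hb d
      refine ⟨h + k, J.add_mem hJ kJ, fun m hm => ?_, fun m hm => ?_⟩
      · rw [coeff_add, h0 m hm, k0 m hm, add_zero]
      · rw [add_smul, coeff_add, coeff_add, h1 m hm, k1 m hm]

theorem coeff_eq_zero_of_totalDegree_lt_degree {𝕜 : Type} [Field 𝕜] {n : ℕ}
    {p : MvPolynomial (Fin n) 𝕜} {m : Fin n →₀ ℕ} (h : p.totalDegree < m.degree) :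
    coeff m p = 0 :=
  coeff_eq_zero_of_totalDegree_lt h

theorem homogeneousComponent_mem_leadingFormIdeal {𝕜 : Type} [Field 𝕜] {n : ℕ}
    {J : Ideal (MvPolynomial (Fin n) 𝕜)} {p : MvPolynomial (Fin n) 𝕜} (hp : p ∈ J)
    {e : ℕ} (he : p.totalDegree ≤ e) :
    homogeneousComponent e p ∈ leadingFormIdeal J := by
  intro d
  by_cases hd : d = e
  · refine ⟨p, hp, fun m hm => coeff_eq_zero_of_totalDegree_lt_degree (by omega),
      fun m hm => ?_⟩
    rw [coeff_homogeneousComponent, if_pos (hm.trans hd)]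
  · refine ⟨0, J.zero_mem, by simp, fun m hm => ?_⟩
    rw [coeff_homogeneousComponent, if_neg (by omega), coeff_zero]

theorem coeff_eq_zero_of_mem_span_monomial {𝕜 : Type} [Field 𝕜] {n : ℕ}
    {S : Set (Fin n →₀ ℕ)} {v : MvPolynomial (Fin n) 𝕜}
    (hv : v ∈ Submodule.span 𝕜 ((fun u => monomial u (1 : 𝕜)) '' S))
    {m : Fin n →₀ ℕ} (hm : m ∉ S) : coeff m v = 0 := by
  induction hv using Submodule.span_induction with
  | mem x hx =>
    obtain ⟨u, hu, rfl⟩ := hx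
    exact (coeff_monomial _ _ _).trans (if_neg (ne_of_mem_of_not_mem hu hm))
  | zero => simp
  | add x y _ _ hx hy => simp [hx, hy]
  | smul a x _ hx => simp [hx]

theorem homogeneousComponent_mem_span_monomial {𝕜 : Type} [Field 𝕜] {n : ℕ}
    {S : Set (Fin n →₀ ℕ)} {v : MvPolynomial (Fin n) 𝕜}
    (hv : v ∈ Submodule.span 𝕜 ((fun u => monomial u (1 : 𝕜)) '' S)) (d : ℕ) :
    homogeneousComponent d v ∈ Submodule.span 𝕜 ((fun u => monomial u (1 : 𝕜)) '' S) := by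
  rw [homogeneousComponent_apply]
  refine Submodule.sum_mem _ fun m hm => ?_
  have hmS : m ∈ S := by
    by_contra h
    exact mem_support_iff.mp (Finset.mem_filter.mp hm).1 (coeff_eq_zero_of_mem_span_monomial hv h)
  have : monomial m (coeff m v) = coeff m v • monomial m (1 : 𝕜) := by
    rw [smul_monomial, smul_eq_mul, mul_one]
  rw [this]
  exact Submodule.smul_mem _ _ (Submodule.subset_span ⟨m, hmS, rfl⟩)

/-- Monomials spanning modulo the leading forms of `J` span modulo `J`. -/
theorem span_monomial_sup_eq_top {𝕜 : Type} [Field 𝕜] {n : ℕ}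
    {J : Ideal (MvPolynomial (Fin n) 𝕜)} {S : Set (Fin n →₀ ℕ)}
    (hS : Submodule.span 𝕜 ((fun u => monomial u (1 : 𝕜)) '' S) ⊔
      (leadingFormIdeal J).restrictScalars 𝕜 = ⊤) :
    Submodule.span 𝕜 ((fun u => monomial u (1 : 𝕜)) '' S) ⊔ J.restrictScalars 𝕜 = ⊤ := by
  set V := Submodule.span 𝕜 ((fun u => monomial u (1 : 𝕜)) '' S)
  have key : ∀ (N : ℕ) (g : MvPolynomial (Fin n) 𝕜),
      (∀ m, N ≤ m.degree → coeff m g = 0) → g ∈ V ⊔ J.restrictScalars 𝕜 := by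
    intro N
    induction N with
    | zero =>
      intro g hg
      have : g = 0 := by
        ext m
        simpa using hg m (Nat.zero_le _)
      rw [this]
      exact Submodule.zero_mem _
    | succ N ih =>
      intro g hg
      obtain ⟨v, hv, k, hk, hvk⟩ := Submodule.mem_sup.mp (hS ▸ Submodule.mem_top : g ∈ _)
      obtain ⟨h, hJ, h0, h1⟩ := hk N
      have hw := homogeneousComponent_mem_span_monomial hv N
      have hrest : g - (homogeneousComponent N v + h) ∈ V ⊔ J.restrictScalars 𝕜 := by
        refine ih _ fun m hm => ?_
        rw [coeff_sub, coeff_add, coeff_homogeneousComponent]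
        rcases hm.eq_or_lt with hm | hm
        · rw [if_pos hm.symm, h1 m hm.symm, ← hvk, coeff_add, sub_self]
        · rw [if_neg hm.ne', h0 m hm, hg m hm, add_zero, sub_zero]
      have := Submodule.add_mem _ hrest (Submodule.add_mem_sup hw hJ)
      rwa [sub_add_cancel] at this
  refine eq_top_iff.mpr fun g _ => key (g.totalDegree + 1) g fun m hm => ?_
  exact coeff_eq_zero_of_totalDegree_lt_degree hm

theorem span_image_mk_eq_top_iff {𝕜 : Type} [Field 𝕜] {n : ℕ}
    (J : Ideal (MvPolynomial (Fin n) 𝕜)) (T : Set (MvPolynomial (Fin n) 𝕜)) :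
    Submodule.span 𝕜 (Ideal.Quotient.mkₐ 𝕜 J '' T) = ⊤ ↔
      Submodule.span 𝕜 T ⊔ J.restrictScalars 𝕜 = ⊤ := by
  have hker : LinearMap.ker (Ideal.Quotient.mkₐ 𝕜 J).toLinearMap = J.restrictScalars 𝕜 := by
    ext x
    simp [Ideal.Quotient.eq_zero_iff_mem]
  have hrange : LinearMap.range (Ideal.Quotient.mkₐ 𝕜 J).toLinearMap = ⊤ :=
    LinearMap.range_eq_top.mpr (Ideal.Quotient.mkₐ_surjective 𝕜 J)
  rw [← hker, ← Submodule.comap_map_eq, Submodule.map_span]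
  refine ⟨fun h => ?_, fun h => ?_⟩
  · exact (congrArg (Submodule.comap _) h).trans (Submodule.comap_top _)
  · rw [eq_top_iff, ← hrange]
    exact LinearMap.range_le_iff_comap.mpr h

theorem rank_quotient_le_of_le_leadingFormIdeal {𝕜 : Type} [Field 𝕜] {n : ℕ}
    {J K : Ideal (MvPolynomial (Fin n) 𝕜)} (hK : K ≤ leadingFormIdeal J) :
    Module.rank 𝕜 (MvPolynomial (Fin n) 𝕜 ⧸ J) ≤
      Module.rank 𝕜 (MvPolynomial (Fin n) 𝕜 ⧸ K) := by
  let mon : (Fin n →₀ ℕ) → MvPolynomial (Fin n) 𝕜 := fun u => monomial u 1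
  obtain ⟨S, -, -, hspan, hli⟩ := exists_linearIndepOn_extension (K := 𝕜)
    (v := fun u => Ideal.Quotient.mkₐ 𝕜 K (mon u)) (linearIndepOn_empty 𝕜 _)
    (Set.empty_subset Set.univ)
  have hmon : Submodule.span 𝕜 (Set.range mon) = ⊤ := by
    have h := (basisMonomials (Fin n) 𝕜).span_eq
    rwa [coe_basisMonomials] at h
  have hKtop : Submodule.span 𝕜 (Ideal.Quotient.mkₐ 𝕜 K '' (mon '' S)) = ⊤ := by
    rw [eq_top_iff, ← (span_image_mk_eq_top_iff K (Set.range mon)).mpr (by rw [hmon, top_sup_eq]),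
      Submodule.span_le, ← Set.image_univ, Set.image_image, Set.image_image]
    exact hspan
  have hKsup := (span_image_mk_eq_top_iff K _).mp hKtop
  have hJtop : Submodule.span 𝕜 (Ideal.Quotient.mkₐ 𝕜 J '' (mon '' S)) = ⊤ :=
    (span_image_mk_eq_top_iff J _).mpr <| span_monomial_sup_eq_top <|
      eq_top_iff.mpr <| hKsup.ge.trans <| sup_le_sup_left (fun _ hx => hK hx) _
  calc Module.rank 𝕜 (MvPolynomial (Fin n) 𝕜 ⧸ J)
      = Module.rank 𝕜 (Submodule.span 𝕜 (Ideal.Quotient.mkₐ 𝕜 J '' (mon '' S))) := by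
        rw [hJtop, rank_top]
    _ ≤ Cardinal.mk (Ideal.Quotient.mkₐ 𝕜 J '' (mon '' S)) := rank_span_le _
    _ ≤ Cardinal.mk S := Cardinal.mk_image_le.trans Cardinal.mk_image_le
    _ ≤ Module.rank 𝕜 (MvPolynomial (Fin n) 𝕜 ⧸ K) := hli.linearIndependent.cardinal_le_rank

/-- **Lemma 4.1** (richness does not decrease under the dilation degeneration):
if the affine `k`-plane `V` is cut out by the degree-≤1 polynomials `f i`,
with degree-1 homogeneous parts `λ i` cutting out the parallel plane `V₀` through
the origin, then `|S₀ ∩ V₀| ≥ |S ∩ V|`. -/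
theorem dilation_degeneration_richness
    (𝕜 : Type) [Field 𝕜] (n s : ℕ) (I : Ideal (MvPolynomial (Fin n) 𝕜))
    (f : Fin s → MvPolynomial (Fin n) 𝕜)
    (hf : ∀ i, (f i).totalDegree ≤ 1) :
    Module.rank 𝕜 (MvPolynomial (Fin n) 𝕜 ⧸
        (I + Ideal.span (Set.range f))) ≤
      Module.rank 𝕜 (MvPolynomial (Fin n) 𝕜 ⧸
        (inIdeal I + Ideal.span
          (Set.range (fun i => MvPolynomial.homogeneousComponent 1 (f i))))) := by
  refine rank_quotient_le_of_le_leadingFormIdeal (sup_le ?_ ?_)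
  · refine Ideal.span_le.mpr ?_
    rintro _ ⟨g, hg, -, rfl⟩
    exact homogeneousComponent_mem_leadingFormIdeal (Ideal.mem_sup_left hg) le_rfl
  · refine Ideal.span_le.mpr ?_
    rintro _ ⟨i, rfl⟩
    exact homogeneousComponent_mem_leadingFormIdeal
      (Ideal.mem_sup_right (Ideal.subset_span (Set.mem_range_self i))) (hf i)
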